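/- arXiv:math/0312025 — 2 statements merged into one kernel-verified Lean document; each statement's English description precedes it below -/
import Mathlib

section
/- For every integer g ≥ 1 and every odd integer d with d ≥ 9g + 19, there exist odd integers d₁ ≥ d₂ ≥ d₃ such that d₃ > 3g + 3, gcd(d₁, gcd(d₂, d₃)) = 1, and d₁ + d₂ + d₃ = d. -/
theorem Odd.int_gcd_add_two_self {m : ℤ} (hm : Odd m) : Int.gcd (m + 2) m = 1 := by
  obtain ⟨k, rfl⟩ := hm
  exact Int.isCoprime_iff_gcd_eq_one.mp ⟨-k, k + 1, by ring⟩

/-- Arithmetic existence claim for `k = 3`: for `g ≥ 1` and odd `d ≥ 9g + 19`, there exist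
odd integers `d₁ ≥ d₂ ≥ d₃ > 3g + 3` with no common factor and `d₁ + d₂ + d₃ = d`. -/
theorem exists_indecomposable_triple
    (g d : ℤ) (hg : 1 ≤ g) (hd_odd : Odd d) (hd : 9 * g + 19 ≤ d) :
    ∃ d₁ d₂ d₃ : ℤ, Odd d₁ ∧ Odd d₂ ∧ Odd d₃ ∧ d₂ ≤ d₁ ∧ d₃ ≤ d₂ ∧ 3 * g + 3 < d₃ ∧
      Int.gcd d₁ (Int.gcd d₂ d₃) = 1 ∧ d₁ + d₂ + d₃ = d := by
  obtain ⟨m, hm, hgm, hmd⟩ : ∃ m : ℤ, Odd m ∧ 3 * g + 3 < m ∧ 3 * m + 4 ≤ d := by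
    rcases Int.even_or_odd g with hg' | hg'
    · exact ⟨3 * g + 5, by grind, by omega, by omega⟩
    · exact ⟨3 * g + 4, by grind, by omega, by omega⟩
  refine ⟨d - 2 * m - 2, m + 2, m, by grind, by grind, hm, by omega, by omega, hgm, ?_, by ring⟩
  simp [hm.int_gcd_add_two_self]
end

section
/- For all integers g ≥ 1 and d ≥ 12g + 4, there exist an integer b ≥ 0 and permutations τ, σ₁, …, σ_b of a set with d elements such that: every cycle in the cycle decomposition of τ has odd length; each σᵢ is a 3-cycle; τ · σ₁ ⋯ σ_b is the identity; the subgroup generated by τ, σ₁, …, σ_b is the alternating group A_d; and (d − c(τ)) + 2b = 2d + 2g − 2, where c(τ) denotes the number of orbits of τ on the d points (cycles counted including fixed points). -/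
open Equiv Equiv.Perm Pointwise in
/-- A permutation group containing, for every point `i ≠ o`, a 3-cycle through `o` and `i`
contains the alternating group. -/
theorem alternatingGroup_le_of_threeCycles_through
    {α : Type*} [Fintype α] [DecidableEq α] [Nontrivial α] (G : Subgroup (Perm α)) (o : α)
    (hG : ∀ i, i ≠ o → ∃ x y, x ≠ o ∧ y ≠ o ∧ x ≠ y ∧ (i = x ∨ i = y) ∧
      swap o x * swap o y ∈ G) :
    alternatingGroup α ≤ G := by
  have apply_o : ∀ x y : α, x ≠ y → y ≠ o → (swap o x * swap o y) o = y := by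
    intro x y hxy hy
    simp [swap_apply_of_ne_of_ne hy hxy.symm]
  have apply_y : ∀ x y : α, (swap o x * swap o y) y = x := by
    intro x y
    simp
  have apply_x : ∀ x y : α, x ≠ o → x ≠ y → (swap o x * swap o y) x = o := by
    intro x y hx hxy
    simp [swap_apply_of_ne_of_ne hx hxy]
  have htrans : MulAction.IsPretransitive G α := by
    refine MulAction.IsPretransitive.of_orbit (x₀ := o) fun i ↦ ?_
    by_cases hi : i = o
    · exact hi ▸ MulAction.mem_orbit_self o
    obtain ⟨x, y, hx, hy, hxy, hixy, hmem⟩ := hG i hi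
    rcases hixy with rfl | rfl
    · refine ⟨⟨_, hmem⟩⁻¹, ?_⟩
      exact inv_smul_eq_iff.mpr (apply_x i y hx hxy).symm
    · exact ⟨⟨_, hmem⟩, apply_o x i hxy hy⟩
  have hprim : MulAction.IsPreprimitive G α := by
    refine MulAction.IsPreprimitive.of_isTrivialBlock_base o fun {B} ho hB ↦ ?_
    rw [MulAction.IsTrivialBlock, or_iff_not_imp_left, Set.not_subsingleton_iff]
    intro hnt
    obtain ⟨a, ha, hao⟩ := hnt.exists_ne o
    refine Set.eq_univ_of_forall fun i ↦ ?_
    by_cases hi : i = o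
    · exact hi ▸ ho
    obtain ⟨x, y, hx, hy, hxy, hixy, hmem⟩ := hG i hi
    have hstab : (⟨_, hmem⟩ : G) • B = B := by
      by_cases hax : a = x
      · refine hB.smul_eq_of_mem ha ?_
        subst hax
        simpa only [Subgroup.mk_smul, Perm.smul_def, apply_x a y hx hxy] using ho
      by_cases hay : a = y
      · refine hB.smul_eq_of_mem ho ?_
        subst hay
        simpa only [Subgroup.mk_smul, Perm.smul_def, apply_o x a hxy hy] using ha
      · refine hB.smul_eq_of_mem ha ?_
        have hfix : (swap o x * swap o y) a = a := by
          simp [swap_apply_of_ne_of_ne hao hax, swap_apply_of_ne_of_ne hao hay]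
        simpa only [Subgroup.mk_smul, Perm.smul_def, hfix] using ha
    have hmap : ∀ z ∈ B, (swap o x * swap o y) z ∈ B := fun z hz ↦
      hstab ▸ Set.smul_mem_smul_set (a := (⟨_, hmem⟩ : G)) hz
    have hyB : y ∈ B := by simpa only [apply_o x y hxy hy] using hmap o ho
    have hxB : x ∈ B := by simpa only [apply_y] using hmap y hyB
    rcases hixy with rfl | rfl <;> assumption
  obtain ⟨i, hi⟩ := exists_ne o
  obtain ⟨x, y, hx, hy, hxy, -, hmem⟩ := hG i hi
  exact alternatingGroup_le_of_isPreprimitive_of_isThreeCycle_mem hprim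
    (isThreeCycle_swap_mul_swap_same hx.symm hy.symm hxy) hmem

/-- The orbits of the trivial permutation are the points. -/
theorem card_orbitRel_quotient_zpowers_one (α : Type*) :
    Nat.card (MulAction.orbitRel.Quotient (Subgroup.zpowers (1 : Equiv.Perm α)) α) =
      Nat.card α := by
  refine (Nat.card_congr (Equiv.ofBijective
    (Quotient.mk (MulAction.orbitRel (Subgroup.zpowers (1 : Equiv.Perm α)) α))
    ⟨fun x y h ↦ ?_, Quotient.mk_surjective⟩)).symm
  obtain ⟨⟨g, hg⟩, rfl⟩ := Quotient.exact h
  rw [Subgroup.zpowers_one_eq_bot, Subgroup.mem_bot] at hg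
  subst hg
  rfl

theorem List.prod_flatMap_pair_inv {ι G : Type*} [Group G] (c : ι → G) (l : List ι) :
    (l.flatMap fun j ↦ [c j, (c j)⁻¹]).prod = 1 := by
  induction l with
  | nil => simp
  | cons j l ih => simp [ih]

open Equiv Equiv.Perm in
/-- For `b ≥ d ≥ 3` there are `b` 3-cycles with trivial product generating `A_d`. -/
theorem exists_threeCycles_prod_eq_one_closure_eq_alternatingGroup
    {d b : ℕ} (hd : 3 ≤ d) (hb : d ≤ b) :
    ∃ σ : Fin b → Perm (Fin d),
      (∀ i, IsThreeCycle (σ i)) ∧ (List.ofFn σ).prod = 1 ∧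
        Subgroup.closure (Set.range σ) = alternatingGroup (Fin d) := by
  let o : Fin d := ⟨0, by omega⟩
  let x : ℕ → Fin d := fun j ↦ ⟨min (2 * j + 1) (d - 2), by omega⟩
  let y : ℕ → Fin d := fun j ↦ ⟨min (2 * j + 2) (d - 1), by omega⟩
  let c : ℕ → Perm (Fin d) := fun j ↦ swap o (x j) * swap o (y j)
  have hx : ∀ j, x j ≠ o := fun j ↦ by simp only [x, o, ne_eq, Fin.mk.injEq]; omega
  have hy : ∀ j, y j ≠ o := fun j ↦ by simp only [y, o, ne_eq, Fin.mk.injEq]; omega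
  have hxy : ∀ j, x j ≠ y j := fun j ↦ by simp only [x, y, ne_eq, Fin.mk.injEq]; omega
  have hc : ∀ j, IsThreeCycle (c j) := fun j ↦
    isThreeCycle_swap_mul_swap_same (hx j).symm (hy j).symm (hxy j)
  obtain ⟨L, hlen, hthree, hprod, hmem⟩ : ∃ L : List (Perm (Fin d)), L.length = b ∧
      (∀ s ∈ L, IsThreeCycle s) ∧ L.prod = 1 ∧ ∀ j, 2 * j + 1 < d → c j ∈ L := by
    obtain ⟨m, rfl | rfl⟩ := b.even_or_odd'
    · refine ⟨(List.range m).flatMap fun j ↦ [c j, (c j)⁻¹], ?_, ?_,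
        List.prod_flatMap_pair_inv c _, fun j hj ↦ ?_⟩
      · simp [mul_comm]
      · simp only [List.mem_flatMap, List.mem_cons, List.not_mem_nil, or_false]
        rintro s ⟨j, -, rfl | rfl⟩
        exacts [hc j, (hc j).inv]
      · exact List.mem_flatMap.mpr ⟨j, List.mem_range.mpr (by omega), by simp⟩
    · obtain ⟨m, rfl⟩ : ∃ n, m = n + 1 := ⟨m - 1, by omega⟩
      have hcube : c 0 ^ 3 = 1 := (hc 0).orderOf ▸ pow_orderOf_eq_one (c 0)
      refine ⟨List.replicate 3 (c 0) ++
        (List.range m).flatMap fun j ↦ [c (j + 1), (c (j + 1))⁻¹], ?_, ?_, ?_, fun j hj ↦ ?_⟩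
      · simp
        omega
      · simp only [List.mem_append, List.mem_replicate, List.mem_flatMap, List.mem_cons,
          List.not_mem_nil, or_false]
        rintro s (⟨-, rfl⟩ | ⟨j, -, rfl | rfl⟩)
        exacts [hc 0, hc _, (hc _).inv]
      · rw [List.prod_append, List.prod_replicate, hcube,
          List.prod_flatMap_pair_inv (fun j ↦ c (j + 1)), one_mul]
      · rw [List.mem_append]
        rcases j with - | j
        · exact Or.inl (by simp)
        · exact Or.inr (List.mem_flatMap.mpr ⟨j, List.mem_range.mpr (by omega), by simp⟩)
  subst hlen
  refine ⟨L.get, fun i ↦ hthree _ (L.get_mem i), by rw [List.ofFn_get, hprod],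
    le_antisymm ?_ ?_⟩
  · rw [Subgroup.closure_le]
    rintro _ ⟨i, rfl⟩
    exact (hthree _ (L.get_mem i)).mem_alternatingGroup
  · have : Nontrivial (Fin d) := ⟨o, x 0, (hx 0).symm⟩
    refine alternatingGroup_le_of_threeCycles_through _ o fun i hi ↦ ?_
    have hi0 : (i : ℕ) ≠ 0 := fun h ↦ hi (Fin.ext h)
    have hid := i.isLt
    refine ⟨x ((i - 1) / 2), y ((i - 1) / 2), hx _, hy _, hxy _, ?_,
      Subgroup.subset_closure (List.mem_iff_get.mp (hmem _ (by omega)))⟩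
    simp only [x, y, Fin.ext_iff]
    omega


/-- Branch cycle description of a simple odd ramification covering of degree `d ≥ 12g + 4`
with monodromy group `A_d` (combinatorial content of Theorem 2): there are a permutation `τ`
with all cycles of odd length and 3-cycles `σ₁, …, σ_b` whose product with `τ` is the
identity, generating the alternating group, and satisfying the Riemann–Hurwitz relation
`(d − c(τ)) + 2b = 2d + 2g − 2`, where `c(τ)` is the number of orbits of `τ`. -/
theorem exists_branch_cycle_description_alternating
    (g d : ℕ) (hg : 1 ≤ g) (hd : 12 * g + 4 ≤ d) :
    ∃ (b : ℕ) (τ : Equiv.Perm (Fin d)) (σ : Fin b → Equiv.Perm (Fin d)),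
      (∀ n ∈ τ.cycleType, Odd n) ∧
      (∀ i, Equiv.Perm.IsThreeCycle (σ i)) ∧
      τ * (List.ofFn σ).prod = 1 ∧
      Subgroup.closure (insert τ (Set.range σ)) = alternatingGroup (Fin d) ∧
      ((d : ℤ) -
          (Nat.card (MulAction.orbitRel.Quotient (Subgroup.zpowers τ) (Fin d)) : ℤ)) +
        2 * b = 2 * d + 2 * g - 2 := by
  obtain ⟨σ, hthree, hprod, hgen⟩ :=
    exists_threeCycles_prod_eq_one_closure_eq_alternatingGroup
      (d := d) (b := d + g - 1) (by omega) (by omega)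
  refine ⟨d + g - 1, 1, σ, by simp, hthree, by rw [one_mul, hprod], ?_, ?_⟩
  · rw [Subgroup.closure_insert_one, hgen]
  · rw [card_orbitRel_quotient_zpowers_one, Nat.card_fin]
    omega
end
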